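/- Let n ≥ 1 and let U ⊆ ℝⁿ be open. Let f : U → ℝ be twice continuously differentiable, let A : U → Matrix (Fin n) (Fin n) ℝ be continuously differentiable with A(x) symmetric positive semidefinite for every x ∈ U, and let ρ : U → ℝ be continuously differentiable with ρ(x) > 0 for all x ∈ U. Assume there is δ > 0 such that ⟨∇f(x), A(x) ∇f(x)⟩ ≥ δ for all x ∈ U. Let K₀ ≥ 0, and for each real s ≥ 1 let w_s : U → ℝ be continuously differentiable with ∫_U w_s(x)² ρ(x) dx ≤ 1 and ∫_U ⟨∇w_s − (s/2) w_s ∇f, A (∇w_s − (s/2) w_s ∇f)⟩(x) ρ(x) dx ≤ K₀. Then for every compact set K ⊆ U, ∫_K w_s(x)² ρ(x) dx → 0 as s → +∞. -/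

import Mathlib

open MeasureTheory

/-- The quadratic form `⟨ξ, M ζ⟩ = ∑ᵢⱼ ξᵢ Mᵢⱼ ζⱼ` (Euclidean inner product of `ξ`
with the matrix-vector product `M ζ`). -/
noncomputable def quadForm {n : ℕ} (M : Matrix (Fin n) (Fin n) ℝ)
    (ξ ζ : EuclideanSpace ℝ (Fin n)) : ℝ :=
  ∑ i, ∑ j, ξ i * M i j * ζ j

open Set Filter Topology

section QuadForm

variable {n : ℕ} (M : Matrix (Fin n) (Fin n) ℝ) (ξ η ζ : EuclideanSpace ℝ (Fin n)) (c : ℝ)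

lemma quadForm_eq_sum_mul : quadForm M ξ ζ = ∑ j, (∑ i, ξ i * M i j) * ζ j := by
  unfold quadForm
  rw [Finset.sum_comm]
  simp only [Finset.sum_mul]

lemma quadForm_add_right : quadForm M ξ (η + ζ) = quadForm M ξ η + quadForm M ξ ζ := by
  simp [quadForm, mul_add, Finset.sum_add_distrib]

lemma quadForm_add_left : quadForm M (ξ + η) ζ = quadForm M ξ ζ + quadForm M η ζ := by
  simp [quadForm, add_mul, Finset.sum_add_distrib]

lemma quadForm_smul_right : quadForm M ξ (c • ζ) = c * quadForm M ξ ζ := by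
  simp only [quadForm, Finset.mul_sum, PiLp.smul_apply, smul_eq_mul]
  refine Finset.sum_congr rfl fun i _ => Finset.sum_congr rfl fun j _ => ?_
  ring

lemma quadForm_smul_left : quadForm M (c • ξ) ζ = c * quadForm M ξ ζ := by
  simp only [quadForm, Finset.mul_sum, PiLp.smul_apply, smul_eq_mul]
  refine Finset.sum_congr rfl fun i _ => Finset.sum_congr rfl fun j _ => ?_
  ring

variable {M} in
lemma quadForm_comm (hM : M.IsSymm) : quadForm M ξ ζ = quadForm M ζ ξ := by
  unfold quadForm
  rw [Finset.sum_comm]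
  refine Finset.sum_congr rfl fun i _ => Finset.sum_congr rfl fun j _ => ?_
  rw [hM.apply]
  ring

variable {M} in
lemma quadForm_add_smul_self (hM : M.IsSymm) :
    quadForm M (η + c • ξ) (η + c • ξ) =
      quadForm M η η + 2 * c * quadForm M ξ η + c ^ 2 * quadForm M ξ ξ := by
  rw [quadForm_add_left, quadForm_add_right, quadForm_add_right, quadForm_smul_left,
    quadForm_smul_right, quadForm_smul_left, quadForm_smul_right, quadForm_comm η ξ hM]
  ring

end QuadForm

lemma gradient_euclideanSpace_apply {n : ℕ} (f : EuclideanSpace ℝ (Fin n) → ℝ)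
    (x : EuclideanSpace ℝ (Fin n)) (i : Fin n) :
    gradient f x i = fderiv ℝ f x (EuclideanSpace.single i 1) := by
  rw [← (InnerProductSpace.toDual ℝ _).apply_symm_apply (fderiv ℝ f x),
    InnerProductSpace.toDual_apply_apply, EuclideanSpace.inner_single_right]
  simp [gradient]

section CompactSupport

variable {E : Type*} [NormedAddCommGroup E] [NormedSpace ℝ E]

lemma ContDiff.mul_of_tsupport_subset {U : Set E} (hU : IsOpen U) {k : WithTop ℕ∞}
    {φ h : E → ℝ} (hφ : ContDiff ℝ k φ) (hφU : tsupport φ ⊆ U) (hh : ContDiffOn ℝ k h U) :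
    ContDiff ℝ k (fun x => φ x * h x) := by
  refine contDiff_iff_contDiffAt.2 fun x => ?_
  by_cases hx : x ∈ tsupport φ
  · exact hφ.contDiffAt.mul (hh.contDiffAt (hU.mem_nhds (hφU hx)))
  · refine (contDiffAt_const (c := (0 : ℝ))).congr_of_eventuallyEq ?_
    filter_upwards [notMem_tsupport_iff_eventuallyEq.1 hx] with y hy
    simp [hy]

lemma IsCompact.exists_contDiff_cutoff [FiniteDimensional ℝ E] {K U : Set E}
    (hK : IsCompact K) (hU : IsOpen U) (hKU : K ⊆ U) :
    ∃ φ : E → ℝ, ContDiff ℝ 1 φ ∧ HasCompactSupport φ ∧ tsupport φ ⊆ U ∧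
      (∀ x ∈ K, φ x = 1) ∧ ∀ x, φ x ∈ Icc (0 : ℝ) 1 := by
  obtain ⟨L, hL, hKL, hLU⟩ := exists_compact_between hK hU hKU
  obtain ⟨φ, h1, h0, hI⟩ := exists_contMDiffMap_one_nhds_of_subset_interior
    (n := 1) (modelWithCornersSelf ℝ E) hK.isClosed hKL
  have hsub : tsupport φ ⊆ L := closure_minimal
    (fun x hx => by_contra fun hxL => hx (h0 x hxL)) hL.isClosed
  exact ⟨φ, φ.contMDiff.contDiff, HasCompactSupport.intro hL h0, hsub.trans hLU,
    fun x hx => h1.self_of_nhdsSet x hx, hI⟩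

variable [MeasurableSpace E] [BorelSpace E] {μ : Measure E}

lemma HasCompactSupport.integrable_fderiv_apply [IsFiniteMeasureOnCompacts μ]
    {V : E → ℝ} (hV : ContDiff ℝ 1 V) (hc : HasCompactSupport V) (v : E) :
    Integrable (fun x => fderiv ℝ V x v) μ :=
  ((hV.continuous_fderiv one_ne_zero).clm_apply continuous_const).integrable_of_hasCompactSupport
    (hc.fderiv_apply ℝ v)

lemma HasCompactSupport.integral_fderiv_apply_eq_zero [FiniteDimensional ℝ E]
    [μ.IsAddHaarMeasure] {V : E → ℝ} (hV : ContDiff ℝ 1 V)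
    (hc : HasCompactSupport V) (v : E) : ∫ x, fderiv ℝ V x v ∂μ = 0 := by
  have key := integral_mul_fderiv_eq_neg_fderiv_mul_of_integrable (μ := μ) (𝕜 := ℝ)
    (f := fun _ : E => (1 : ℝ)) (g := V) (v := v) (by simp)
    (by simpa using hc.integrable_fderiv_apply hV v)
    (by simpa using hV.continuous.integrable_of_hasCompactSupport hc)
    (fun _ _ => differentiableAt_const _)
    (fun x _ => (hV.differentiable one_ne_zero).differentiableAt)
  simpa using key

end CompactSupport

/-- Local-coordinate content of Lemma 3.2 (`μ(M₁) = 0`): on a chart where the metric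
quadratic form of `∇f` is bounded below by `δ > 0`, the normalized densities `w_s² ρ`
with uniformly bounded drift Dirichlet energy lose all their mass on every compact
subset as `s → +∞`. -/
theorem stmt8 (n : ℕ) (hn : 1 ≤ n)
    (U : Set (EuclideanSpace ℝ (Fin n))) (hU : IsOpen U)
    (f : EuclideanSpace ℝ (Fin n) → ℝ) (hf : ContDiffOn ℝ 2 f U)
    (A : EuclideanSpace ℝ (Fin n) → Matrix (Fin n) (Fin n) ℝ)
    (hA : ∀ i j, ContDiffOn ℝ 1 (fun x => A x i j) U)
    (hAsym : ∀ x ∈ U, (A x).IsSymm)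
    (hApsd : ∀ x ∈ U, ∀ ξ : EuclideanSpace ℝ (Fin n), 0 ≤ quadForm (A x) ξ ξ)
    (ρ : EuclideanSpace ℝ (Fin n) → ℝ) (hρ : ContDiffOn ℝ 1 ρ U)
    (hρpos : ∀ x ∈ U, 0 < ρ x)
    (δ : ℝ) (hδ : 0 < δ)
    (hgradf : ∀ x ∈ U, δ ≤ quadForm (A x) (gradient f x) (gradient f x))
    (K₀ : ℝ) (hK₀ : 0 ≤ K₀)
    (w : ℝ → EuclideanSpace ℝ (Fin n) → ℝ)
    (hw : ∀ s : ℝ, 1 ≤ s → ContDiffOn ℝ 1 (w s) U)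
    (hwint : ∀ s : ℝ, 1 ≤ s → IntegrableOn (fun x => (w s x) ^ 2 * ρ x) U)
    (hwnorm : ∀ s : ℝ, 1 ≤ s → (∫ x in U, (w s x) ^ 2 * ρ x) ≤ 1)
    (heint : ∀ s : ℝ, 1 ≤ s →
      IntegrableOn (fun x =>
        quadForm (A x) (gradient (w s) x - ((s / 2) * w s x) • gradient f x)
          (gradient (w s) x - ((s / 2) * w s x) • gradient f x) * ρ x) U)
    (henergy : ∀ s : ℝ, 1 ≤ s →
      (∫ x in U,
        quadForm (A x) (gradient (w s) x - ((s / 2) * w s x) • gradient f x)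
          (gradient (w s) x - ((s / 2) * w s x) • gradient f x) * ρ x) ≤ K₀) :
    ∀ K : Set (EuclideanSpace ℝ (Fin n)), IsCompact K → K ⊆ U →
      Filter.Tendsto (fun s : ℝ => ∫ x in K, (w s x) ^ 2 * ρ x)
        Filter.atTop (nhds 0) := by
  intro K hK hKU
  obtain ⟨φ, hφ, hφc, hφU, hφK, hφI⟩ := hK.exists_contDiff_cutoff hU hKU
  set e : Fin n → EuclideanSpace ℝ (Fin n) := fun j => EuclideanSpace.single j 1 with he
  set X : Fin n → EuclideanSpace ℝ (Fin n) → ℝ := fun j x => ∑ i, gradient f x i * A x i j with hX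
  have hgradf1 : ∀ i, ContDiffOn ℝ 1 (fun x => gradient f x i) U := by
    intro i
    simp only [gradient_euclideanSpace_apply]
    exact (hf.fderiv_of_isOpen hU (by norm_num)).clm_apply contDiffOn_const
  have hX1 : ∀ j, ContDiffOn ℝ 1 (X j) U := fun j =>
    ContDiffOn.sum fun i _ => (hgradf1 i).mul (hA i j)
  set q : EuclideanSpace ℝ (Fin n) → ℝ :=
    fun x => quadForm (A x) (gradient f x) (gradient f x) with hq
  have hqc : ContinuousOn q U := by
    simp only [hq, quadForm_eq_sum_mul]
    exact continuousOn_finsetSum _ fun j _ => ((hX1 j).mul (hgradf1 j)).continuousOn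
  set B : Fin n → EuclideanSpace ℝ (Fin n) → ℝ := fun j x => φ x * (ρ x * X j x) with hB
  have hB1 : ∀ j, ContDiff ℝ 1 (B j) := fun j =>
    hφ.mul_of_tsupport_subset hU hφU (hρ.mul (hX1 j))
  have hBsupp : ∀ j, tsupport (B j) ⊆ tsupport φ := fun j =>
    closure_mono (Function.support_mul_subset_left φ _)
  set divB : EuclideanSpace ℝ (Fin n) → ℝ := fun x => ∑ j, fderiv ℝ (B j) x (e j) with hdivB
  have hdivBc : Continuous divB := continuous_finsetSum _ fun j _ =>
    ((hB1 j).continuous_fderiv one_ne_zero).clm_apply continuous_const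
  obtain ⟨C₁, hC₁⟩ := hφc.isCompact.exists_bound_of_continuousOn
    (f := fun x => divB x / ρ x)
    (hdivBc.continuousOn.div (hρ.continuousOn.mono hφU) fun x hx => (hρpos x (hφU hx)).ne')
  obtain ⟨C₂, hC₂⟩ := hφc.isCompact.exists_bound_of_continuousOn (hqc.mono hφU)
  have hdivB_le : ∀ x ∈ U, -(|C₁| * ρ x) ≤ divB x := by
    intro x hx
    have hρx := hρpos x hx
    by_cases hxφ : x ∈ tsupport φ
    · have h := (neg_le_of_abs_le (hC₁ x hxφ)).trans' (neg_le_neg (le_abs_self C₁))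
      rw [le_div_iff₀ hρx] at h
      linarith
    · have h0 : divB x = 0 := Finset.sum_eq_zero fun j _ => by
        rw [fderiv_of_notMem_tsupport ℝ fun h => hxφ (hBsupp j h)]
        rfl
      rw [h0]
      have := mul_nonneg (abs_nonneg C₁) hρx.le
      linarith
  have hq_le : ∀ x ∈ U, φ x * q x ≤ |C₂| := by
    intro x hx
    by_cases hxφ : x ∈ tsupport φ
    · have h1 : q x ≤ |C₂| := (le_abs_self _).trans ((hC₂ x hxφ).trans (le_abs_self _))
      have h2 : 0 ≤ q x := hδ.le.trans (hgradf x hx)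
      have h3 := (hφI x).2
      nlinarith
    · rw [image_eq_zero_of_notMem_tsupport hxφ, zero_mul]
      exact abs_nonneg _
  have hbound : ∀ s : ℝ, 1 ≤ s →
      ∫ x in K, (w s x) ^ 2 * ρ x ≤ (|C₁| + |C₂| + K₀) / δ * s⁻¹ := by
    intro s hs
    have hw1 := hw s hs
    set Q : EuclideanSpace ℝ (Fin n) → ℝ := fun x =>
      quadForm (A x) (gradient (w s) x - ((s / 2) * w s x) • gradient f x)
        (gradient (w s) x - ((s / 2) * w s x) • gradient f x) with hQ
    set V : Fin n → EuclideanSpace ℝ (Fin n) → ℝ := fun j x => B j x * (w s x) ^ 2 with hV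
    have hV1 : ∀ j, ContDiff ℝ 1 (V j) := fun j =>
      (hB1 j).mul_of_tsupport_subset hU ((hBsupp j).trans hφU) (hw1.pow 2)
    have hVsupp : ∀ j, tsupport (V j) ⊆ tsupport φ := fun j =>
      (closure_mono (Function.support_mul_subset_left (B j) _)).trans (hBsupp j)
    have hVc : ∀ j, HasCompactSupport (V j) := fun j =>
      hφc.isCompact.of_isClosed_subset (isClosed_tsupport _) (hVsupp j)
    set D : EuclideanSpace ℝ (Fin n) → ℝ := fun x => ∑ j, fderiv ℝ (V j) x (e j) with hD
    have hDint : Integrable D := integrable_finsetSum _ fun j _ =>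
      (hVc j).integrable_fderiv_apply (hV1 j) _
    have hD0 : ∫ x in U, D x = 0 := by
      rw [setIntegral_eq_integral_of_forall_compl_eq_zero]
      · rw [integral_finsetSum _ fun j _ => (hVc j).integrable_fderiv_apply (hV1 j) _]
        exact Finset.sum_eq_zero fun j _ => (hVc j).integral_fderiv_apply_eq_zero (hV1 j) _
      · intro x hx
        refine Finset.sum_eq_zero fun j _ => ?_
        rw [fderiv_of_notMem_tsupport ℝ fun h => hx (hφU (hVsupp j h))]
        rfl
    have hDeq : ∀ x ∈ U, D x = divB x * (w s x) ^ 2 +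
        2 * φ x * ρ x * w s x * quadForm (A x) (gradient f x) (gradient (w s) x) := by
      intro x hx
      have hwd : DifferentiableAt ℝ (w s) x :=
        (hw1.contDiffAt (hU.mem_nhds hx)).differentiableAt one_ne_zero
      rw [quadForm_eq_sum_mul]
      simp only [hD, hdivB, Finset.sum_mul, Finset.mul_sum, ← Finset.sum_add_distrib]
      refine Finset.sum_congr rfl fun j _ => ?_
      have hd : HasFDerivAt (V j) _ x :=
        ((hB1 j).differentiable one_ne_zero x).hasFDerivAt.mul (hwd.hasFDerivAt.pow 2)
      rw [hd.fderiv, gradient_euclideanSpace_apply (w s)]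
      simp only [hB, hX, he, add_apply, smul_apply, smul_eq_mul,
        Finset.mul_sum, Finset.sum_mul, nsmul_eq_mul]
      simp only [← Finset.mul_sum, ← Finset.sum_mul]
      push_cast
      ring
    have hpt : ∀ x ∈ U, φ x * (s * δ * ((w s x) ^ 2 * ρ x)) ≤
        D x + (|C₁| + |C₂|) * ((w s x) ^ 2 * ρ x) + Q x * ρ x := by
      intro x hx
      have hρx := hρpos x hx
      have hφ0 := (hφI x).1
      have hφ1 := (hφI x).2
      set ξ := gradient f x with hξ
      set η := gradient (w s) x - ((s / 2) * w s x) • ξ with hη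
      have hQx : Q x = quadForm (A x) η η := rfl
      have hqx : q x = quadForm (A x) ξ ξ := rfl
      have hgw : quadForm (A x) ξ (gradient (w s) x) =
          quadForm (A x) ξ η + (s / 2) * w s x * q x := by
        rw [hqx, ← quadForm_smul_right, ← quadForm_add_right, hη, sub_add_cancel]
      have hcs : 0 ≤ Q x + 2 * w s x * quadForm (A x) ξ η + (w s x) ^ 2 * q x := by
        rw [hQx, hqx, ← quadForm_add_smul_self ξ η (w s x) (hAsym x hx)]
        exact hApsd x hx _
      have hQ0 : 0 ≤ Q x := hApsd x hx _
      have hδq : δ ≤ q x := hgradf x hx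
      have hw2 := sq_nonneg (w s x)
      rw [hDeq x hx, hgw]
      have h1 := mul_le_mul_of_nonneg_right (hdivB_le x hx) hw2
      have h2 := mul_nonneg (mul_nonneg hφ0 hρx.le) hcs
      have h3 := mul_le_mul_of_nonneg_right (hq_le x hx) (mul_nonneg hw2 hρx.le)
      have h4 := mul_le_mul_of_nonneg_right hφ1 (mul_nonneg hQ0 hρx.le)
      have h5 := mul_le_mul_of_nonneg_left hδq
        (mul_nonneg (mul_nonneg hφ0 (zero_le_one.trans hs)) (mul_nonneg hw2 hρx.le))
      linarith
    have hmass0 : ∀ x ∈ U, 0 ≤ (w s x) ^ 2 * ρ x := fun x hx =>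
      mul_nonneg (sq_nonneg _) (hρpos x hx).le
    have hs0 : 0 < s := zero_lt_one.trans_le hs
    have hi1 : IntegrableOn (fun x => (|C₁| + |C₂|) * ((w s x) ^ 2 * ρ x)) U :=
      (hwint s hs).const_mul _
    have hi2 : IntegrableOn (fun x => D x + (|C₁| + |C₂|) * ((w s x) ^ 2 * ρ x)) U :=
      hDint.integrableOn.add hi1
    have hi3 : IntegrableOn (fun x => Q x * ρ x) U := heint s hs
    have hR : IntegrableOn
        (fun x => D x + (|C₁| + |C₂|) * ((w s x) ^ 2 * ρ x) + Q x * ρ x) U := hi2.add hi3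
    have hmain : s * δ * ∫ x in K, (w s x) ^ 2 * ρ x ≤ |C₁| + |C₂| + K₀ := calc
      s * δ * ∫ x in K, (w s x) ^ 2 * ρ x = ∫ x in K, s * δ * ((w s x) ^ 2 * ρ x) :=
        (integral_const_mul _ _).symm
      _ ≤ ∫ x in K, (D x + (|C₁| + |C₂|) * ((w s x) ^ 2 * ρ x) + Q x * ρ x) := by
        refine setIntegral_mono_on (((hwint s hs).mono_set hKU).const_mul _)
          (hR.mono_set hKU) hK.measurableSet fun x hx => ?_
        simpa [hφK x hx] using hpt x (hKU hx)
      _ ≤ ∫ x in U, (D x + (|C₁| + |C₂|) * ((w s x) ^ 2 * ρ x) + Q x * ρ x) := by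
        refine setIntegral_mono_set hR ?_ hKU.eventuallyLE
        refine (ae_restrict_iff' hU.measurableSet).2 (ae_of_all _ fun x hx => ?_)
        exact (mul_nonneg (hφI x).1
          (mul_nonneg (mul_nonneg hs0.le hδ.le) (hmass0 x hx))).trans (hpt x hx)
      _ = (|C₁| + |C₂|) * (∫ x in U, (w s x) ^ 2 * ρ x) + ∫ x in U, Q x * ρ x := by
        rw [integral_add hi2 hi3, integral_add hDint.integrableOn hi1, hD0, zero_add,
          integral_const_mul]
      _ ≤ (|C₁| + |C₂|) * 1 + K₀ := by
        gcongr
        · exact hwnorm s hs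
        · exact henergy s hs
      _ = |C₁| + |C₂| + K₀ := by ring
    rw [← div_eq_mul_inv, div_div, le_div_iff₀ (mul_pos hδ hs0)]
    linarith
  refine tendsto_of_tendsto_of_tendsto_of_le_of_le' tendsto_const_nhds
    (by simpa using tendsto_inv_atTop_zero.const_mul ((|C₁| + |C₂| + K₀) / δ)) ?_
    ((eventually_ge_atTop 1).mono hbound)
  exact Eventually.of_forall fun s => setIntegral_nonneg hK.measurableSet fun x hx =>
    mul_nonneg (sq_nonneg _) (hρpos x (hKU hx)).le
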